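/- Let Ω ⊂ ℝ² be a closed polygon, and let 0 < α ≤ 1, A₀, A₁, A₂ > 0, a₀ ≥ 0, and a₁ ≥ a₂ be real numbers. Then there exists c₄ > 0 such that for every ε > 0, every triangulation K of Ω satisfying sin φ ≥ A₀ ε^{a₀} for every angle φ of every triangular face of K and A₁ ε^{a₁} ≤ |e| ≤ A₂ ε^{a₂} for every edge e of K, every h : Ω → ℝ² with ‖h‖_α := ‖h‖_∞ + |h|_α < ∞, and every function Πh : Ω → ℝ² that is piecewise affine over K and coincides with h at every vertex of K, one has |Πh|_α ≤ c₄ · ‖h‖_α · ε^{−α(a₀ + a₁ − α a₂)}. -/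

import Mathlib

open Set Geometry EuclideanGeometry Metric Real

noncomputable section

abbrev E2 : Type := EuclideanSpace ℝ (Fin 2)

/-- The set of Hölder ratios of exponent `α` of `u` on `S`. -/
def holderRatioSet (α : ℝ) (S : Set E2) (u : E2 → E2) : Set ℝ :=
  {c | ∃ x ∈ S, ∃ y ∈ S, x ≠ y ∧ c = ‖u x - u y‖ / ‖x - y‖ ^ α}

/-- The Hölder seminorm of exponent `α` of `u` on `S`. -/
def holderSeminorm (α : ℝ) (S : Set E2) (u : E2 → E2) : ℝ :=
  sSup (holderRatioSet α S u)

/-- The supremum norm of `u` on `S`. -/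
def supNorm (S : Set E2) (u : E2 → E2) : ℝ :=
  sSup ((fun x => ‖u x‖) '' S)

/-- `f` is a homeomorphism of `S` onto its image `f '' S`. -/
def IsHomeoOn (f : E2 → E2) (S : Set E2) : Prop :=
  ContinuousOn f S ∧ Set.InjOn f S ∧ ContinuousOn (Function.invFunOn f S) (f '' S)

/-- `K` is a triangulation of `Ω`. -/
def IsTriangulation (K : SimplicialComplex ℝ E2) (Ω : Set E2) : Prop :=
  K.faces.Finite ∧ (∀ s ∈ K.faces, s.card ≤ 3) ∧ K.space = Ω ∧
    ∀ s ∈ K.faces, ∃ t ∈ K.faces, s ⊆ t ∧ t.card = 3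

/-- A closed polygon: a compact set admitting a triangulation. -/
def IsClosedPolygon (Ω : Set E2) : Prop :=
  IsCompact Ω ∧ ∃ K : SimplicialComplex ℝ E2, IsTriangulation K Ω

/-- `f` is piecewise affine over the simplicial complex `K`. -/
def PiecewiseAffineOn (f : E2 → E2) (K : SimplicialComplex ℝ E2) : Prop :=
  ∀ s ∈ K.faces, ∃ A : E2 →ᵃ[ℝ] E2, ∀ x ∈ convexHull ℝ (s : Set E2), f x = A x

/-- Every angle of every triangular face of `K` has sine at least `c`. -/
def AngleLB (K : SimplicialComplex ℝ E2) (c : ℝ) : Prop :=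
  ∀ s ∈ K.faces, ∀ p ∈ s, ∀ q ∈ s, ∀ r ∈ s,
    p ≠ q → q ≠ r → p ≠ r → c ≤ Real.sin (∠ p q r)

/-- Length of an edge (a two-element face). -/
def edgeLen (e : Finset E2) : ℝ := Metric.diam (e : Set E2)

/-- `o` is the incenter of the triangle `p₁p₂p₃` with inradius `r`. -/
def IsIncenter (p₁ p₂ p₃ o : E2) (r : ℝ) : Prop :=
  o ∈ interior (convexHull ℝ {p₁, p₂, p₃}) ∧
  Metric.infDist o (affineSpan ℝ ({p₁, p₂} : Set E2) : Set E2) = r ∧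
  Metric.infDist o (affineSpan ℝ ({p₂, p₃} : Set E2) : Set E2) = r ∧
  Metric.infDist o (affineSpan ℝ ({p₃, p₁} : Set E2) : Set E2) = r


section
variable {E : Type*} [NormedAddCommGroup E] [NormedSpace ℝ E]

/-- Disjoint faces of a finite simplicial complex are uniformly separated. -/
lemma exists_pos_le_norm_sub_of_disjoint_faces (K : SimplicialComplex ℝ E)
    (hK : K.faces.Finite) :
    ∃ δ > (0 : ℝ), ∀ s ∈ K.faces, ∀ t ∈ K.faces, Disjoint s t →
      ∀ x ∈ convexHull ℝ (s : Set E), ∀ y ∈ convexHull ℝ (t : Set E), δ ≤ ‖x - y‖ := by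
  have key : ∀ᶠ δ in nhdsWithin (0 : ℝ) (Ioi 0), ∀ s ∈ K.faces, ∀ t ∈ K.faces, Disjoint s t →
      ∀ x ∈ convexHull ℝ (s : Set E), ∀ y ∈ convexHull ℝ (t : Set E), δ ≤ ‖x - y‖ := by
    rw [Filter.eventually_all_finite hK]
    intro s hs
    rw [Filter.eventually_all_finite hK]
    intro t ht
    by_cases hst : Disjoint s t
    · have hdisj : Disjoint (convexHull ℝ (s : Set E)) (convexHull ℝ (t : Set E)) := by
        rw [Set.disjoint_iff_inter_eq_empty, K.convexHull_inter_convexHull hs ht,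
          Set.disjoint_iff_inter_eq_empty.1 (Finset.disjoint_coe.2 hst), convexHull_empty]
      obtain ⟨r, hr, hrd⟩ := exists_pos_forall_lt_edist
        (s.finite_toSet.isCompact_convexHull (𝕜 := ℝ)) (t.finite_toSet.isClosed_convexHull (𝕜 := ℝ)) hdisj
      filter_upwards [Ioo_mem_nhdsGT (show (0 : ℝ) < r by exact_mod_cast hr)] with δ hδ _ x hx y hy
      have h1 := hrd x hx y hy
      rw [edist_dist, ← ENNReal.ofReal_coe_nnreal, ENNReal.ofReal_lt_ofReal_iff'] at h1
      rw [← dist_eq_norm]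
      exact (hδ.2.trans h1.1).le
    · exact Filter.Eventually.of_forall fun _ h => absurd h hst
  obtain ⟨δ, h, hδ⟩ := (key.and self_mem_nhdsWithin).exists
  exact ⟨δ, hδ, h⟩

/-- The difference of two nonnegative combinations, of equal total mass `m` and with disjoint
supports, of the vertices of two faces has norm at least `δ * m`. -/
lemma mul_le_norm_sum_sub_sum (K : SimplicialComplex ℝ E) {δ : ℝ}
    (hδ : ∀ s ∈ K.faces, ∀ t ∈ K.faces, Disjoint s t →
      ∀ x ∈ convexHull ℝ (s : Set E), ∀ y ∈ convexHull ℝ (t : Set E), δ ≤ ‖x - y‖)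
    {s t u : Finset E} (hs : s ∈ K.faces) (ht : t ∈ K.faces) {a b : E → ℝ} {m : ℝ}
    (ha : ∀ p, 0 ≤ a p) (hb : ∀ p, 0 ≤ b p) (hab : ∀ p, a p = 0 ∨ b p = 0)
    (has : ∀ p, p ∉ s → a p = 0) (hbt : ∀ p, p ∉ t → b p = 0)
    (hsu : s ⊆ u) (htu : t ⊆ u)
    (hma : ∑ p ∈ u, a p = m) (hmb : ∑ p ∈ u, b p = m) (hm : 0 ≤ m) :
    δ * m ≤ ‖∑ p ∈ u, a p • p - ∑ p ∈ u, b p • p‖ := by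
  classical
  rcases hm.eq_or_lt with rfl | hm
  · simp
  have main : ∀ (s : Finset E) (a : E → ℝ), s ∈ K.faces → (∀ p, 0 ≤ a p) →
      (∀ p, p ∉ s → a p = 0) → s ⊆ u → ∑ p ∈ u, a p = m →
      (s.filter (a · ≠ 0)) ∈ K.faces ∧
        m⁻¹ • ∑ p ∈ u, a p • p ∈ convexHull ℝ ((s.filter (a · ≠ 0) : Finset E) : Set E) := by
    intro s a hs ha has hsu hma
    have hsub : s.filter (a · ≠ 0) ⊆ u := (Finset.filter_subset _ _).trans hsu
    have hzero : ∀ p ∈ u, p ∉ s.filter (a · ≠ 0) → a p = 0 := by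
      intro p _ hp
      by_contra h
      exact hp (Finset.mem_filter.2 ⟨by_contra fun h' => h (has p h'), h⟩)
    have h1 : ∑ p ∈ s.filter (a · ≠ 0), a p = m := by
      rw [← hma]; exact Finset.sum_subset hsub hzero
    have h2 : ∑ p ∈ s.filter (a · ≠ 0), a p • p = ∑ p ∈ u, a p • p :=
      Finset.sum_subset hsub fun p hp hp' => by rw [hzero p hp hp', zero_smul]
    refine ⟨K.down_closed hs (Finset.filter_subset _ _) ?_, ?_⟩
    · exact Finset.nonempty_of_sum_ne_zero (h1.trans_ne hm.ne')
    · have := Finset.centerMass_mem_convexHull (R := ℝ) (s.filter (a · ≠ 0)) (w := a) (z := id)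
        (fun p _ => ha p) (by rw [h1]; exact hm)
        (s := ((s.filter (a · ≠ 0) : Finset E) : Set E)) (fun p hp => hp)
      rwa [Finset.centerMass, h1, show (∑ i ∈ s.filter (a · ≠ 0), a i • id i)
        = ∑ p ∈ u, a p • p from h2] at this
  obtain ⟨hs', hx⟩ := main s a hs ha has hsu hma
  obtain ⟨ht', hy⟩ := main t b ht hb hbt htu hmb
  have h := hδ _ hs' _ ht' (by
    rw [Finset.disjoint_left]
    intro p hp hq
    rcases hab p with h | h
    · exact (Finset.mem_filter.1 hp).2 h
    · exact (Finset.mem_filter.1 hq).2 h) _ hx _ hy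
  rw [← smul_sub, norm_smul, norm_inv, Real.norm_of_nonneg hm.le] at h
  rwa [← div_eq_inv_mul, le_div_iff₀ hm] at h

/-- Barycentric coordinates of a point of the convex hull of `s`, extended by zero outside `s`. -/
lemma exists_weights_of_mem_convexHull {s u : Finset E} (hsu : s ⊆ u) {x : E}
    (hx : x ∈ convexHull ℝ (s : Set E)) :
    ∃ w : E → ℝ, (∀ p, 0 ≤ w p) ∧ (∀ p, p ∉ s → w p = 0) ∧ ∑ p ∈ u, w p = 1 ∧
      ∑ p ∈ u, w p • p = x := by
  classical
  obtain ⟨w, hw0, hw1, hwx⟩ := Finset.mem_convexHull'.1 hx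
  refine ⟨fun p => if p ∈ s then w p else 0, fun p => ?_, fun p hp => by simp [hp], ?_, ?_⟩
  · dsimp only
    split_ifs with h
    exacts [hw0 p h, le_rfl]
  · rw [← hw1, ← Finset.sum_subset hsu fun p _ hp => by simp [hp]]
    exact Finset.sum_congr rfl fun p hp => by simp [hp]
  · rw [← hwx, ← Finset.sum_subset hsu fun p _ hp => by simp [hp]]
    exact Finset.sum_congr rfl fun p hp => by simp [hp]

/-- Linear regularity of the faces of a finite simplicial complex: two points of two faces are
either far apart, or joined by a two-segment path inside the faces of length comparable to their
distance. -/
lemma exists_linear_regularity (K : SimplicialComplex ℝ E) (hK : K.faces.Finite) :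
    ∃ C > (0 : ℝ), ∀ s ∈ K.faces, ∀ t ∈ K.faces,
      ∀ x ∈ convexHull ℝ (s : Set E), ∀ y ∈ convexHull ℝ (t : Set E),
        1 ≤ C * ‖x - y‖ ∨ ∃ z ∈ convexHull ℝ (s : Set E) ∩ convexHull ℝ (t : Set E),
          ‖x - z‖ ≤ C * ‖x - y‖ ∧ ‖y - z‖ ≤ C * ‖x - y‖ := by
  classical
  obtain ⟨δ, hδ0, hδ⟩ := exists_pos_le_norm_sub_of_disjoint_faces K hK
  have hbdd : Bornology.IsBounded (⋃ s ∈ K.faces, convexHull ℝ (s : Set E)) :=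
    (hK.isCompact_biUnion fun s _ => (s.finite_toSet.isCompact_convexHull (𝕜 := ℝ))).isBounded
  obtain ⟨D, hD0, hD⟩ := hbdd.exists_pos_norm_le
  refine ⟨(1 + 2 * D) / δ, by positivity, fun s hs t ht x hx y hy => ?_⟩
  set u := s ∪ t with hu
  have hsu : s ⊆ u := Finset.subset_union_left
  have htu : t ⊆ u := Finset.subset_union_right
  obtain ⟨l, hl0, hls, hl1, hlx⟩ := exists_weights_of_mem_convexHull hsu hx
  obtain ⟨k, hk0, hkt, hk1, hky⟩ := exists_weights_of_mem_convexHull htu hy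
  set ν : E → ℝ := fun p => min (l p) (k p) with hν
  have hν0 : ∀ p, 0 ≤ ν p := fun p => le_min (hl0 p) (hk0 p)
  have hνs : ∀ p, p ∉ s → ν p = 0 := fun p hp => by simp [hν, hls p hp, hk0 p]
  have hνt : ∀ p, p ∉ t → ν p = 0 := fun p hp => by simp [hν, hkt p hp, hl0 p]
  set m := 1 - ∑ p ∈ u, ν p with hm
  have hm0 : 0 ≤ m := by
    rw [hm, ← hl1, ← Finset.sum_sub_distrib]
    exact Finset.sum_nonneg fun p _ => sub_nonneg.2 (min_le_left _ _)
  have hma : ∑ p ∈ u, (l p - ν p) = m := by rw [Finset.sum_sub_distrib, hl1]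
  have hmb : ∑ p ∈ u, (k p - ν p) = m := by rw [Finset.sum_sub_distrib, hk1]
  have hX : ∑ p ∈ u, (l p - ν p) • p = x - ∑ p ∈ u, ν p • p := by
    simp only [sub_smul, Finset.sum_sub_distrib, hlx]
  have hY : ∑ p ∈ u, (k p - ν p) • p = y - ∑ p ∈ u, ν p • p := by
    simp only [sub_smul, Finset.sum_sub_distrib, hky]
  have hsep : δ * m ≤ ‖x - y‖ := by
    have := mul_le_norm_sum_sub_sum K hδ (u := u) hs ht
      (a := fun p => l p - ν p) (b := fun p => k p - ν p) (m := m)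
      (fun p => sub_nonneg.2 (min_le_left _ _)) (fun p => sub_nonneg.2 (min_le_right _ _))
      (fun p => by
        rcases le_total (l p) (k p) with h | h
        · left; simp [hν, h]
        · right; simp [hν, h])
      (fun p hp => by simp [hls p hp, hνs p hp]) (fun p hp => by simp [hkt p hp, hνt p hp])
      hsu htu hma hmb hm0
    rwa [hX, hY, sub_sub_sub_cancel_right] at this
  have hnorm : ∀ p ∈ u, ‖p‖ ≤ D := by
    intro p hp
    rcases Finset.mem_union.1 hp with h | h
    · exact hD p (mem_biUnion hs (subset_convexHull ℝ _ h))
    · exact hD p (mem_biUnion ht (subset_convexHull ℝ _ h))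
  have hsum : ∀ a : E → ℝ, (∀ p, 0 ≤ a p) → ∑ p ∈ u, a p = m → ‖∑ p ∈ u, a p • p‖ ≤ m * D := by
    intro a ha hma
    rw [← hma, Finset.sum_mul]
    refine norm_sum_le_of_le _ fun p hp => ?_
    rw [norm_smul, Real.norm_of_nonneg (ha p)]
    exact mul_le_mul_of_nonneg_left (hnorm p hp) (ha p)
  have hpos : (0 : ℝ) ≤ 2 * D := by positivity
  have hnn := norm_nonneg (x - y)
  by_cases hm1 : m = 1
  · left
    rw [hm1, mul_one] at hsep
    rw [div_mul_eq_mul_div, le_div_iff₀ hδ0]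
    nlinarith
  right
  have hνpos : 0 < ∑ p ∈ u, ν p :=
    lt_of_le_of_ne (Finset.sum_nonneg fun p _ => hν0 p) fun h => hm1 (by rw [hm, ← h, sub_zero])
  set z := (∑ p ∈ u, ν p)⁻¹ • ∑ p ∈ u, ν p • p with hz
  have hzmem : ∀ v : Finset E, v ⊆ u → (∀ p, p ∉ v → ν p = 0) → z ∈ convexHull ℝ (v : Set E) := by
    intro v hvu hv
    have h1 : ∑ p ∈ v, ν p = ∑ p ∈ u, ν p := Finset.sum_subset hvu fun p _ hp => hv p hp
    have h2 : ∑ p ∈ v, ν p • p = ∑ p ∈ u, ν p • p :=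
      Finset.sum_subset hvu fun p _ hp => by rw [hv p hp, zero_smul]
    have := Finset.centerMass_mem_convexHull (R := ℝ) v (w := ν) (z := id)
      (fun p _ => hν0 p) (by rw [h1]; exact hνpos) (s := (v : Set E)) (fun p hp => hp)
    rwa [Finset.centerMass, h1, show (∑ i ∈ v, ν i • id i) = ∑ p ∈ u, ν p • p from h2] at this
  have hzs := hzmem s hsu hνs
  have hzt := hzmem t htu hνt
  have hzD : ‖z‖ ≤ D := hD z (mem_biUnion hs hzs)
  have hZ : ∑ p ∈ u, ν p • p = (1 - m) • z := by
    rw [hz, hm, sub_sub_cancel, smul_inv_smul₀ hνpos.ne']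
  have hdist : ∀ w : E, ‖w - ∑ p ∈ u, ν p • p‖ ≤ m * D →
      ‖w - z‖ ≤ (1 + 2 * D) / δ * ‖x - y‖ := by
    intro w hw
    have h1 : w - z = (w - ∑ p ∈ u, ν p • p) - m • z := by rw [hZ]; module
    have h2 : ‖w - z‖ ≤ m * D + m * D := by
      rw [h1]
      refine (norm_sub_le _ _).trans (add_le_add hw ?_)
      rw [norm_smul, Real.norm_of_nonneg hm0]
      exact mul_le_mul_of_nonneg_left hzD hm0
    rw [div_mul_eq_mul_div, le_div_iff₀ hδ0]
    nlinarith [mul_le_mul_of_nonneg_left hsep hpos, mul_le_mul_of_nonneg_right h2 hδ0.le]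
  refine ⟨z, ⟨hzs, hzt⟩, hdist x ?_, hdist y ?_⟩
  · rw [← hX]; exact hsum _ (fun p => sub_nonneg.2 (min_le_left _ _)) hma
  · rw [← hY]; exact hsum _ (fun p => sub_nonneg.2 (min_le_right _ _)) hmb

/-- A function on an interval covered by finitely many closed sets, on each of which it is
Lipschitz with constant `L`, satisfies the corresponding estimate between the endpoints. -/
lemma norm_sub_le_of_finite_closed_cover {F : Type*} [SeminormedAddCommGroup F] (f : ℝ → F)
    (L : ℝ) (S : Finset (Set ℝ)) :
    ∀ a b : ℝ, a ≤ b → Icc a b ⊆ ⋃ s ∈ S, s → (∀ s ∈ S, IsClosed s) →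
      (∀ s ∈ S, ∀ x ∈ s, ∀ y ∈ s, ‖f x - f y‖ ≤ L * |x - y|) → ‖f b - f a‖ ≤ L * (b - a) := by
  classical
  induction hn : S.card generalizing S with
  | zero =>
    intro a b hab hcov
    rw [Finset.card_eq_zero] at hn
    subst hn
    simpa using hcov (left_mem_Icc.2 hab)
  | succ n ih =>
    intro a b hab hcov hcl hL
    obtain ⟨s, hs, has⟩ := mem_iUnion₂.1 (hcov (left_mem_Icc.2 hab))
    have hcpt : IsCompact (s ∩ Icc a b) := isCompact_Icc.inter_left (hcl s hs)
    obtain ⟨c, ⟨hcs, hac, hcb⟩, hcmax⟩ :=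
      hcpt.exists_isGreatest ⟨a, has, left_mem_Icc.2 hab⟩
    have h1 : ‖f c - f a‖ ≤ L * (c - a) := by
      have := hL s hs c hcs a has
      rwa [abs_of_nonneg (sub_nonneg.2 hac)] at this
    rcases hcb.eq_or_lt with rfl | hcb
    · exact h1
    have hcl' : IsClosed (⋃ t ∈ S.erase s, t) :=
      (S.erase s).finite_toSet.isClosed_biUnion fun t ht => hcl t (Finset.mem_of_mem_erase ht)
    have hsub : Ioc c b ⊆ ⋃ t ∈ S.erase s, t := by
      intro x hx
      obtain ⟨t, ht, hxt⟩ := mem_iUnion₂.1 (hcov ⟨hac.trans hx.1.le, hx.2⟩)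
      refine mem_iUnion₂.2 ⟨t, Finset.mem_erase.2 ⟨?_, ht⟩, hxt⟩
      rintro rfl
      exact absurd (hcmax ⟨hxt, hac.trans hx.1.le, hx.2⟩) (not_le.2 hx.1)
    have hsub' : Icc c b ⊆ ⋃ t ∈ S.erase s, t := by
      rw [← closure_Ioc hcb.ne]
      exact hcl'.closure_subset_iff.2 hsub
    have h2 := ih (S.erase s) (by rw [Finset.card_erase_of_mem hs, hn]; rfl) c b hcb.le hsub'
      (fun t ht => hcl t (Finset.mem_of_mem_erase ht))
      (fun t ht => hL t (Finset.mem_of_mem_erase ht))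
    calc ‖f b - f a‖ = ‖(f b - f c) + (f c - f a)‖ := by rw [sub_add_sub_cancel]
      _ ≤ L * (b - c) + L * (c - a) := (norm_add_le _ _).trans (add_le_add h2 h1)
      _ = L * (b - a) := by ring

/-- A function which is Lipschitz on every face of a finite simplicial complex is Lipschitz along
segments contained in the underlying space. -/
lemma norm_sub_le_of_segment_subset_space {F : Type*} [SeminormedAddCommGroup F]
    (K : SimplicialComplex ℝ E) (hK : K.faces.Finite) (f : E → F) {L : ℝ}
    (hf : ∀ s ∈ K.faces, ∀ x ∈ convexHull ℝ (s : Set E), ∀ y ∈ convexHull ℝ (s : Set E),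
      ‖f x - f y‖ ≤ L * ‖x - y‖) {x y : E} (hxy : segment ℝ x y ⊆ K.space) :
    ‖f x - f y‖ ≤ L * ‖x - y‖ := by
  classical
  have hcont : Continuous (AffineMap.lineMap y x : ℝ → E) := AffineMap.lineMap_continuous
  have h := norm_sub_le_of_finite_closed_cover (fun r => f (AffineMap.lineMap y x r))
    (L * ‖x - y‖)
    (hK.toFinset.image fun s : Finset E => (AffineMap.lineMap y x : ℝ → E) ⁻¹' convexHull ℝ (s : Set E))
    0 1 zero_le_one ?_ ?_ ?_
  · simpa using h
  · intro r hr
    have hmem : AffineMap.lineMap y x r ∈ K.space := by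
      apply hxy
      rw [segment_symm, segment_eq_image_lineMap]
      exact mem_image_of_mem _ hr
    obtain ⟨s, hs, hrs⟩ := K.mem_space_iff.1 hmem
    exact mem_iUnion₂.2 ⟨_, Finset.mem_image_of_mem _ (hK.mem_toFinset.2 hs), hrs⟩
  · simp only [Finset.forall_mem_image]
    exact fun s _ => (s.finite_toSet.isClosed_convexHull (𝕜 := ℝ)).preimage hcont
  · simp only [Finset.forall_mem_image]
    intro s hs a ha b hb
    refine (hf s (hK.mem_toFinset.1 hs) _ ha _ hb).trans_eq ?_
    rw [← dist_eq_norm (AffineMap.lineMap y x a), dist_lineMap_lineMap, Real.dist_eq,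
      dist_comm, dist_eq_norm]
    ring

end

section
variable {V F : Type*} [NormedAddCommGroup V] [InnerProductSpace ℝ V]
  [NormedAddCommGroup F] [NormedSpace ℝ F]

lemma abs_mul_norm_mul_sin_angle_le (u v : V) (a b : ℝ) :
    |a| * ‖u‖ * Real.sin (InnerProductGeometry.angle u v) ≤ ‖a • u + b • v‖ := by
  set θ := InnerProductGeometry.angle u v with hθ
  have hin : inner ℝ u v = Real.cos θ * (‖u‖ * ‖v‖) :=
    (InnerProductGeometry.cos_angle_mul_norm_mul_norm u v).symm
  refine le_of_sq_le_sq ?_ (norm_nonneg _)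
  have h := norm_add_sq_real (a • u) (b • v)
  rw [inner_smul_left, inner_smul_right, hin, norm_smul, norm_smul, Real.norm_eq_abs,
    Real.norm_eq_abs, mul_pow, mul_pow, sq_abs, sq_abs, conj_trivial] at h
  rw [h, mul_pow, mul_pow, sq_abs, Real.sin_sq]
  nlinarith [sq_nonneg (a * ‖u‖ * Real.cos θ + b * ‖v‖)]

/-- The Lipschitz bound of an affine map on a triangle `pqr` whose vertex values differ by at
most `M`, in terms of a lower bound `e` for two sides and `σ` for the sine of their angle. -/
lemma affine_norm_sub_le_on_triangle (A : V →ᵃ[ℝ] F) {p q r : V} (hpq : p ≠ q) (hqr : q ≠ r)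
    (hpr : p ≠ r) {M e σ : ℝ} (he : 0 < e) (hσ : 0 < σ) (hsin : σ ≤ Real.sin (∠ p q r))
    (hep : e ≤ ‖p - q‖) (her : e ≤ ‖r - q‖) (hMp : ‖A p - A q‖ ≤ M) (hMr : ‖A r - A q‖ ≤ M)
    {x y : V} (hx : x ∈ convexHull ℝ ({p, q, r} : Set V))
    (hy : y ∈ convexHull ℝ ({p, q, r} : Set V)) :
    ‖A x - A y‖ ≤ 2 * M / (e * σ) * ‖x - y‖ := by
  classical
  have main : ∀ x ∈ convexHull ℝ ({p, q, r} : Set V),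
      ∃ a b : ℝ, x = a • (p - q) + b • (r - q) + q := by
    intro x hx
    rw [← Finset.coe_singleton, ← Finset.coe_insert, ← Finset.coe_insert,
      Finset.mem_convexHull'] at hx
    obtain ⟨w, -, hw1, hwx⟩ := hx
    rw [Finset.sum_insert (by simp [hpq, hpr]), Finset.sum_insert (by simp [hqr]),
      Finset.sum_singleton] at hw1 hwx
    refine ⟨w p, w r, ?_⟩
    rw [← hwx, show w q = 1 - w p - w r by linarith]
    module
  obtain ⟨a₁, b₁, h₁⟩ := main x hx
  obtain ⟨a₂, b₂, h₂⟩ := main y hy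
  set a := a₁ - a₂ with ha
  set b := b₁ - b₂ with hb
  have hxy : x - y = a • (p - q) + b • (r - q) := by rw [h₁, h₂, ha, hb]; module
  have hA : A x - A y = a • (A p - A q) + b • (A r - A q) := by
    have hl : ∀ c d : V, A c - A d = A.linear (c - d) := fun c d =>
      (A.linearMap_vsub c d).symm
    rw [hl, hl, hl, hxy, map_add, map_smul, map_smul]
  have hM : 0 ≤ M := (norm_nonneg _).trans hMp
  have hangle : ∠ p q r = InnerProductGeometry.angle (p - q) (r - q) := rfl
  have key : ∀ c n s : ℝ, e ≤ n → σ ≤ s → |c| * n * s ≤ ‖x - y‖ → |c| * (e * σ) ≤ ‖x - y‖ := by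
    intro c n s hn hs h
    refine le_trans ?_ h
    rw [mul_assoc]
    have hn0 : 0 ≤ n := he.le.trans hn
    gcongr
  have hka := key a _ _ hep (hangle ▸ hsin)
    (hxy ▸ abs_mul_norm_mul_sin_angle_le (p - q) (r - q) a b)
  have hkb := key b _ _ her (show σ ≤ Real.sin (InnerProductGeometry.angle (r - q) (p - q)) by
      rw [InnerProductGeometry.angle_comm]; exact hsin)
    (by rw [hxy, add_comm]; exact abs_mul_norm_mul_sin_angle_le (r - q) (p - q) b a)
  have hn : ‖A x - A y‖ ≤ |a| * M + |b| * M := by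
    rw [hA]
    refine norm_add_le_of_le ?_ ?_ <;> rw [norm_smul, Real.norm_eq_abs] <;> gcongr
  rw [div_mul_eq_mul_div, le_div_iff₀ (mul_pos he hσ)]
  nlinarith [mul_le_mul_of_nonneg_right hn (mul_pos he hσ).le]

end

lemma norm_le_supNorm {S : Set E2} {u : E2 → E2} (h : BddAbove ((fun x => ‖u x‖) '' S)) {x : E2}
    (hx : x ∈ S) : ‖u x‖ ≤ supNorm S u :=
  le_csSup h (mem_image_of_mem _ hx)

lemma norm_sub_le_holderSeminorm {α : ℝ} {S : Set E2} {u : E2 → E2}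
    (h : BddAbove (holderRatioSet α S u)) {x y : E2} (hx : x ∈ S) (hy : y ∈ S) (hxy : x ≠ y) :
    ‖u x - u y‖ ≤ holderSeminorm α S u * ‖x - y‖ ^ α := by
  have : ‖u x - u y‖ / ‖x - y‖ ^ α ≤ holderSeminorm α S u := le_csSup h ⟨x, hx, y, hy, hxy, rfl⟩
  rwa [div_le_iff₀ (Real.rpow_pos_of_pos (norm_pos_iff.2 (sub_ne_zero.2 hxy)) _)] at this

lemma holderSeminorm_nonneg (α : ℝ) (S : Set E2) (u : E2 → E2) : 0 ≤ holderSeminorm α S u := by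
  refine Real.sSup_nonneg ?_
  rintro _ ⟨x, -, y, -, -, rfl⟩
  positivity

lemma supNorm_nonneg (S : Set E2) (u : E2 → E2) : 0 ≤ supNorm S u := by
  refine Real.sSup_nonneg ?_
  rintro _ ⟨x, -, rfl⟩
  exact norm_nonneg _

lemma edgeLen_pair (p q : E2) : edgeLen {p, q} = ‖p - q‖ := by
  rw [edgeLen, Finset.coe_pair, Metric.diam_pair, dist_eq_norm]

section
variable {Ω : Set E2} {K : SimplicialComplex ℝ E2} {h Ph : E2 → E2}

lemma IsTriangulation.exists_triangle (hK : IsTriangulation K Ω) {s : Finset E2}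
    (hs : s ∈ K.faces) : ∃ p q r : E2, p ≠ q ∧ p ≠ r ∧ q ≠ r ∧ {p, q, r} ∈ K.faces ∧
      s ⊆ {p, q, r} := by
  obtain ⟨t, ht, hst, hcard⟩ := hK.2.2.2 s hs
  obtain ⟨p, q, r, hpq, hpr, hqr, rfl⟩ := Finset.card_eq_three.1 hcard
  exact ⟨p, q, r, hpq, hpr, hqr, ht, hst⟩

/-- The interpolant is bounded by the supremum norm of the interpolated function. -/
lemma interpolant_norm_le (hK : IsTriangulation K Ω)
    (hb : BddAbove ((fun x => ‖h x‖) '' Ω)) (hP : PiecewiseAffineOn Ph K)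
    (hv : ∀ v : E2, ({v} : Finset E2) ∈ K.faces → Ph v = h v) {x : E2} (hx : x ∈ Ω) :
    ‖Ph x‖ ≤ supNorm Ω h := by
  rw [← hK.2.2.1] at hx
  obtain ⟨s, hs, hxs⟩ := K.mem_space_iff.1 hx
  obtain ⟨A, hA⟩ := hP s hs
  have hsub : convexHull ℝ (s : Set E2) ⊆ A ⁻¹' closedBall 0 (supNorm Ω h) := by
    refine convexHull_min (fun p hp => ?_) ((convex_closedBall _ _).affine_preimage A)
    rw [mem_preimage, mem_closedBall_zero_iff, ← hA p (subset_convexHull ℝ _ hp),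
      hv p (K.down_closed hs (Finset.singleton_subset_iff.2 hp) (Finset.singleton_nonempty p))]
    exact norm_le_supNorm hb (hK.2.2.1 ▸ K.subset_space hs hp)
  rw [hA x hxs]
  exact mem_closedBall_zero_iff.1 (hsub hxs)

/-- The interpolant is Lipschitz on each face, with constant controlled by the angles and the
edge lengths. -/
lemma interpolant_norm_sub_le (hK : IsTriangulation K Ω) {α σ e e' : ℝ} (hα : 0 ≤ α)
    (hσ : 0 < σ) (he : 0 < e) (hang : AngleLB K σ)
    (hedge : ∀ d ∈ K.faces, d.card = 2 → e ≤ edgeLen d ∧ edgeLen d ≤ e')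
    (hH : BddAbove (holderRatioSet α Ω h)) (hP : PiecewiseAffineOn Ph K)
    (hv : ∀ v : E2, ({v} : Finset E2) ∈ K.faces → Ph v = h v)
    {s : Finset E2} (hs : s ∈ K.faces) {x y : E2} (hx : x ∈ convexHull ℝ (s : Set E2))
    (hy : y ∈ convexHull ℝ (s : Set E2)) :
    ‖Ph x - Ph y‖ ≤ 2 * (holderSeminorm α Ω h * e' ^ α) / (e * σ) * ‖x - y‖ := by
  obtain ⟨p, q, r, hpq, hpr, hqr, ht, hst⟩ := hK.exists_triangle hs
  obtain ⟨A, hA⟩ := hP _ ht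
  have hpair : ∀ v ∈ ({p, q, r} : Finset E2), ∀ w ∈ ({p, q, r} : Finset E2), v ≠ w →
      e ≤ ‖v - w‖ ∧ ‖A v - A w‖ ≤ holderSeminorm α Ω h * e' ^ α := by
    intro v hvt w hwt hvw
    have hd : ({v, w} : Finset E2) ∈ K.faces := K.down_closed ht
      (Finset.insert_subset hvt (Finset.singleton_subset_iff.2 hwt)) (Finset.insert_nonempty _ _)
    have hlen := hedge _ hd (Finset.card_pair hvw)
    rw [edgeLen_pair] at hlen
    refine ⟨hlen.1, ?_⟩
    have hval : ∀ z ∈ ({p, q, r} : Finset E2), A z = h z := fun z hz => by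
      rw [← hA z (subset_convexHull ℝ _ hz), hv z (K.down_closed ht
        (Finset.singleton_subset_iff.2 hz) (Finset.singleton_nonempty z))]
    rw [hval v hvt, hval w hwt]
    refine (norm_sub_le_holderSeminorm hH (hK.2.2.1 ▸ K.subset_space ht hvt)
      (hK.2.2.1 ▸ K.subset_space ht hwt) hvw).trans ?_
    exact mul_le_mul_of_nonneg_left (Real.rpow_le_rpow (norm_nonneg _) hlen.2 hα)
      (holderSeminorm_nonneg _ _ _)
  have hmono := convexHull_mono (𝕜 := ℝ) (Finset.coe_subset.2 hst)
  have hpm : p ∈ ({p, q, r} : Finset E2) := by simp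
  have hqm : q ∈ ({p, q, r} : Finset E2) := by simp
  have hrm : r ∈ ({p, q, r} : Finset E2) := by simp
  have h1 := hpair p hpm q hqm hpq
  have h2 := hpair r hrm q hqm hqr.symm
  have hx' := hmono hx
  have hy' := hmono hy
  rw [hA x hx', hA y hy']
  simp only [Finset.coe_insert, Finset.coe_singleton] at hx' hy'
  exact affine_norm_sub_le_on_triangle A hpq hqr hpr he hσ
    (hang _ ht p hpm q hqm r hrm hpq hqr hpr) h1.1 h2.1 h1.2 h2.2 hx' hy'

/-- A global Lipschitz bound for the interpolant, whose constant does not depend on the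
triangulation `K` used for the interpolation. -/
lemma interpolant_norm_sub_le_of_regular (hK : IsTriangulation K Ω)
    {K₀ : SimplicialComplex ℝ E2} (hK₀ : IsTriangulation K₀ Ω) {C G N : ℝ} (hG : 0 ≤ G)
    (hC : ∀ s ∈ K₀.faces, ∀ t ∈ K₀.faces,
      ∀ x ∈ convexHull ℝ (s : Set E2), ∀ y ∈ convexHull ℝ (t : Set E2),
        1 ≤ C * ‖x - y‖ ∨ ∃ z ∈ convexHull ℝ (s : Set E2) ∩ convexHull ℝ (t : Set E2),
          ‖x - z‖ ≤ C * ‖x - y‖ ∧ ‖y - z‖ ≤ C * ‖x - y‖)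
    (hN : ∀ x ∈ Ω, ‖Ph x‖ ≤ N)
    (hL : ∀ s ∈ K.faces, ∀ x ∈ convexHull ℝ (s : Set E2), ∀ y ∈ convexHull ℝ (s : Set E2),
      ‖Ph x - Ph y‖ ≤ G * ‖x - y‖) {x y : E2} (hx : x ∈ Ω) (hy : y ∈ Ω) :
    ‖Ph x - Ph y‖ ≤ 2 * (N + G) * C * ‖x - y‖ := by
  have hN0 : 0 ≤ N := (norm_nonneg _).trans (hN x hx)
  have hx₀ := hx
  have hy₀ := hy
  rw [← hK₀.2.2.1] at hx₀ hy₀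
  obtain ⟨s, hs, hxs⟩ := K₀.mem_space_iff.1 hx₀
  obtain ⟨t, ht, hyt⟩ := K₀.mem_space_iff.1 hy₀
  have hseg : ∀ s ∈ K₀.faces, ∀ x ∈ convexHull ℝ (s : Set E2), ∀ y ∈ convexHull ℝ (s : Set E2),
      ‖Ph x - Ph y‖ ≤ G * ‖x - y‖ := fun s hs x hx y hy =>
    norm_sub_le_of_segment_subset_space K hK.1 Ph hL (by
      rw [hK.2.2.1, ← hK₀.2.2.1]
      exact ((convex_convexHull ℝ _).segment_subset hx hy).trans (K₀.convexHull_subset_space hs))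
  rcases hC s hs t ht x hxs y hyt with h1 | ⟨z, ⟨hzs, hzt⟩, hxz, hyz⟩
  · have h2 : ‖Ph x - Ph y‖ ≤ N + N := norm_sub_le_of_le (hN x hx) (hN y hy)
    nlinarith [mul_le_mul_of_nonneg_left h1 hN0, mul_le_mul_of_nonneg_left h1 hG]
  · have h2 := hseg s hs x hxs z hzs
    have h3 := hseg t ht y hyt z hzt
    have h4 : ‖Ph x - Ph y‖ ≤ ‖Ph x - Ph z‖ + ‖Ph y - Ph z‖ := by
      rw [norm_sub_rev (Ph y)]; exact norm_sub_le_norm_sub_add_norm_sub _ _ _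
    have h5 : 0 ≤ C * ‖x - y‖ := (norm_nonneg _).trans hxz
    nlinarith [mul_le_mul_of_nonneg_left hxz hG, mul_le_mul_of_nonneg_left hyz hG,
      mul_nonneg hN0 h5]

end

/-- Interpolation between a supremum bound and a Lipschitz bound. -/
lemma le_rpow_mul_rpow_of_le {a b d α : ℝ} (hα0 : 0 ≤ α) (hα1 : α ≤ 1) (ha : 0 ≤ a) (hb : a ≤ b)
    (hd : a ≤ d) : a ≤ b ^ α * d ^ (1 - α) := by
  calc a = a ^ α * a ^ (1 - α) := by
        rw [← Real.rpow_add' ha (by simp), add_sub_cancel, Real.rpow_one]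
    _ ≤ b ^ α * d ^ (1 - α) :=
        mul_le_mul (Real.rpow_le_rpow ha hb hα0) (Real.rpow_le_rpow ha hd (sub_nonneg.2 hα1))
          (Real.rpow_nonneg ha _) (Real.rpow_nonneg (ha.trans hb) _)


/-- a priori bound on the Hölder seminorm of the piecewise affine
interpolant of a Hölder function, in terms of the triangulation parameters. -/
theorem statement15 (Ω : Set E2) (hΩ : IsClosedPolygon Ω)
    (α : ℝ) (hα0 : 0 < α) (hα1 : α ≤ 1)
    (A₀ A₁ A₂ : ℝ) (hA₀ : 0 < A₀) (hA₁ : 0 < A₁) (hA₂ : 0 < A₂)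
    (a₀ a₁ a₂ : ℝ) (ha₀ : 0 ≤ a₀) (ha₁₂ : a₂ ≤ a₁) :
    ∃ c₄ > (0 : ℝ), ∀ ε : ℝ, 0 < ε →
      ∀ K : SimplicialComplex ℝ E2, IsTriangulation K Ω →
        AngleLB K (A₀ * ε ^ a₀) →
        (∀ e ∈ K.faces, e.card = 2 →
          A₁ * ε ^ a₁ ≤ edgeLen e ∧ edgeLen e ≤ A₂ * ε ^ a₂) →
      ∀ h : E2 → E2, BddAbove ((fun x => ‖h x‖) '' Ω) →
        BddAbove (holderRatioSet α Ω h) →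
      ∀ Ph : E2 → E2, PiecewiseAffineOn Ph K →
        (∀ v : E2, ({v} : Finset E2) ∈ K.faces → Ph v = h v) →
        holderSeminorm α Ω Ph ≤
          c₄ * (supNorm Ω h + holderSeminorm α Ω h) *
            ε ^ (-α * (a₀ + a₁ - α * a₂)) := by
  obtain ⟨hcpt, K₀, hK₀⟩ := hΩ
  obtain ⟨C, hC0, hC⟩ := exists_linear_regularity K₀ hK₀.1
  obtain ⟨R, hR0, hR⟩ := hcpt.isBounded.exists_pos_norm_le
  -- `q` bounds from below the ratio `e' ^ α / (e * σ)` of the mesh parameters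
  set q : ℝ := (R + R) ^ (α - 1) with hq
  have hq0 : 0 < q := Real.rpow_pos_of_pos (by positivity) _
  set k : ℝ := A₂ ^ α / (A₁ * A₀) with hk
  have hk0 : 0 < k := by positivity
  set B : ℝ := 2 * (q⁻¹ + 2) * C * k with hB
  have hB0 : 0 < B := by positivity
  refine ⟨B ^ α * 2 ^ (1 - α), by positivity, ?_⟩
  intro ε hε K hK hang hedge h hb hH Ph hP hv
  set N := supNorm Ω h with hN
  set H := holderSeminorm α Ω h with hHdef
  have hN0 : 0 ≤ N := supNorm_nonneg _ _
  have hH0 : 0 ≤ H := holderSeminorm_nonneg _ _ _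
  have hσ : 0 < A₀ * ε ^ a₀ := by positivity
  have he : 0 < A₁ * ε ^ a₁ := by positivity
  set Q : ℝ := ε ^ (-(a₀ + a₁ - α * a₂)) with hQ
  have hQ0 : 0 < Q := by positivity
  have hratio : (A₂ * ε ^ a₂) ^ α / (A₁ * ε ^ a₁ * (A₀ * ε ^ a₀)) = k * Q := by
    rw [Real.mul_rpow hA₂.le (by positivity), ← Real.rpow_mul hε.le, hk, hQ,
      show -(a₀ + a₁ - α * a₂) = a₂ * α - (a₁ + a₀) by ring, Real.rpow_sub hε, Real.rpow_add hε]
    field_simp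
  have hexp : ε ^ (-α * (a₀ + a₁ - α * a₂)) = Q ^ α := by
    rw [hQ, ← Real.rpow_mul hε.le]; congr 1; ring
  have hNΩ : ∀ x ∈ Ω, ‖Ph x‖ ≤ N := fun x hx => interpolant_norm_le hK hb hP hv hx
  refine Real.sSup_le ?_ (by positivity)
  rintro _ ⟨x, hx, y, hy, hxy, rfl⟩
  have hxy0 : 0 < ‖x - y‖ := norm_pos_iff.2 (sub_ne_zero.2 hxy)
  rw [hexp, div_le_iff₀ (Real.rpow_pos_of_pos hxy0 _)]
  have hqQ : q ≤ k * Q := by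
    obtain ⟨s, hs, -⟩ := K.mem_space_iff.1 (hK.2.2.1.symm ▸ hx)
    obtain ⟨p, q', r, hpq, hpr, hqr, ht, -⟩ := hK.exists_triangle hs
    have hmem : ∀ v ∈ ({p, q', r} : Finset E2), ‖v‖ ≤ R := fun v hvt =>
      hR v (hK.2.2.1 ▸ K.subset_space ht hvt)
    have hsin : A₀ * ε ^ a₀ ≤ 1 := (hang _ ht p (by simp) q' (by simp) r (by simp) hpq hqr
      hpr).trans (Real.sin_le_one _)
    have hlen := hedge {p, q'} (K.down_closed ht (by
      intro v; simp only [Finset.mem_insert, Finset.mem_singleton]; tauto)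
      (Finset.insert_nonempty _ _)) (Finset.card_pair hpq)
    have hdiam : edgeLen {p, q'} ≤ R + R := by
      rw [edgeLen_pair]; exact norm_sub_le_of_le (hmem p (by simp)) (hmem q' (by simp))
    set e := A₁ * ε ^ a₁
    rw [← hratio]
    calc q ≤ e ^ (α - 1) :=
          Real.rpow_le_rpow_of_nonpos he (hlen.1.trans hdiam) (by linarith)
      _ = e ^ α / e := by rw [Real.rpow_sub he, Real.rpow_one]
      _ ≤ (A₂ * ε ^ a₂) ^ α / (e * (A₀ * ε ^ a₀)) := by
          have := hlen.1.trans hlen.2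
          refine div_le_div₀ (by positivity) (Real.rpow_le_rpow he.le this hα0.le)
            (by positivity) ?_
          exact mul_le_of_le_one_right he.le hsin
  have hlip : ‖Ph x - Ph y‖ ≤ B * (N + H) * Q * ‖x - y‖ := by
    have h1 := interpolant_norm_sub_le_of_regular hK hK₀ (G := 2 * H * (k * Q)) (by positivity)
      hC hNΩ (fun s hs x hx y hy => by
        have := interpolant_norm_sub_le hK hα0.le hσ he hang hedge hH hP hv hs hx hy
        rwa [← mul_assoc 2, mul_div_assoc, hratio] at this) hx hy
    refine h1.trans (mul_le_mul_of_nonneg_right ?_ hxy0.le)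
    have h2 : N ≤ q⁻¹ * (N + H) * (k * Q) := by
      have h3 : 1 ≤ q⁻¹ * (k * Q) := by rwa [← div_eq_inv_mul, one_le_div hq0]
      nlinarith [mul_le_mul_of_nonneg_left h3 (add_nonneg hN0 hH0)]
    have h4 : 2 * H * (k * Q) ≤ 2 * (N + H) * (k * Q) := by gcongr; linarith
    calc 2 * (N + 2 * H * (k * Q)) * C
        ≤ 2 * (q⁻¹ * (N + H) * (k * Q) + 2 * (N + H) * (k * Q)) * C := by gcongr
      _ = B * (N + H) * Q := by rw [hB]; ring
  have hsup : ‖Ph x - Ph y‖ ≤ 2 * (N + H) := by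
    have := norm_sub_le_of_le (hNΩ x hx) (hNΩ y hy)
    linarith
  refine (le_rpow_mul_rpow_of_le hα0.le hα1 (norm_nonneg _) hlip hsup).trans_eq ?_
  have hNH : (N + H) ^ α * (N + H) ^ (1 - α) = N + H := by
    rw [← Real.rpow_add' (by positivity) (by simp), add_sub_cancel, Real.rpow_one]
  rw [Real.mul_rpow (by positivity) hxy0.le, Real.mul_rpow (by positivity) hQ0.le,
    Real.mul_rpow hB0.le (by positivity), Real.mul_rpow zero_le_two (by positivity)]
  linear_combination (B ^ α * 2 ^ (1 - α) * Q ^ α * ‖x - y‖ ^ α) * hNH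

end
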